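/- arXiv:0809.3768 — 2 statements merged into one kernel-verified Lean document; each statement's English description precedes it below -/
import Mathlib

section
/- Let A₁ and A₂ be Hurwitz real 2×2 matrices. If det([A₁,A₂]) ≥ 0, where [A₁,A₂] = A₁A₂ − A₂A₁, then there exists a common quadratic Lyapunov function for the pair (A₁,A₂), i.e. a symmetric positive definite real 2×2 matrix P such that both A₁ᵀP + PA₁ and A₂ᵀP + PA₂ are negative definite. -/
open Matrix

/-- A real 2×2 matrix is Hurwitz: both eigenvalues have negative real part,
equivalently trace < 0 and det > 0. -/
def Hurwitz (A : Matrix (Fin 2) (Fin 2) ℝ) : Prop := A.trace < 0 ∧ 0 < A.det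

lemma posDef_two (x y z : ℝ) (hx : 0 < x) (hd : 0 < x * z - y ^ 2) :
    (!![x, y; y, z] : Matrix (Fin 2) (Fin 2) ℝ).PosDef := by
  refine Matrix.PosDef.of_dotProduct_mulVec_pos ?_ ?_
  · ext i j; fin_cases i <;> fin_cases j <;> simp [Matrix.conjTranspose]
  · intro v hv
    have h : v 0 ≠ 0 ∨ v 1 ≠ 0 := by
      by_contra hc
      push Not at hc
      apply hv
      ext i; fin_cases i
      · exact hc.1
      · exact hc.2
    simp only [dotProduct, mulVec, Fin.sum_univ_two, Pi.star_apply, star_trivial,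
      Matrix.of_apply, Matrix.cons_val_zero, Matrix.cons_val_one, Matrix.cons_val', Matrix.cons_val_fin_one]
    have key : 0 < x * (v 0 * (x * v 0 + y * v 1) + v 1 * (y * v 0 + z * v 1)) := by
      have e : x * (v 0 * (x * v 0 + y * v 1) + v 1 * (y * v 0 + z * v 1))
        = (x * v 0 + y * v 1) ^ 2 + (x * z - y ^ 2) * (v 1) ^ 2 := by ring
      rw [e]
      by_cases h1 : v 1 = 0
      · have h0 : v 0 ≠ 0 := by tauto
        rw [h1]
        have : 0 < (x * v 0) ^ 2 := by positivity
        nlinarith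
      · have : 0 < (x * z - y ^ 2) * (v 1) ^ 2 := by positivity
        nlinarith [sq_nonneg (x * v 0 + y * v 1)]
    exact pos_of_mul_pos_right key hx.le

/-- Solvability of the reduced scalar inequalities. -/
def Good (b₁ e₁ c₁ D₁ b₂ e₂ c₂ D₂ : ℝ) : Prop :=
  ∃ p q r : ℝ, 0 < p ∧ 0 < p * r - q ^ 2 ∧
    (p * b₁ + q * e₁ - r * c₁) ^ 2 < 4 * (p * r - q ^ 2) * D₁ ∧
    (p * b₂ + q * e₂ - r * c₂) ^ 2 < 4 * (p * r - q ^ 2) * D₂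

lemma good_null {b₁ e₁ c₁ D₁ b₂ e₂ c₂ D₂ : ℝ} (h₁ : 0 < D₁) (h₂ : 0 < D₂) (p q r : ℝ)
    (hd : p * r - q ^ 2 = 0) (hne : p ≠ 0 ∨ r ≠ 0)
    (l₁ : p * b₁ + q * e₁ - r * c₁ = 0) (l₂ : p * b₂ + q * e₂ - r * c₂ = 0) :
    Good b₁ e₁ c₁ D₁ b₂ e₂ c₂ D₂ := by
  wlog hp : 0 < p + r generalizing p q r
  · refine this (-p) (-q) (-r) (by linarith) (by simpa using hne) (by linarith) (by linarith) ?_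
    have : p + r ≠ 0 := by
      intro h
      have hr : r = -p := by linarith
      subst hr
      have : p = 0 := by nlinarith
      subst this
      simp at hne
    rcases lt_or_gt_of_ne this with h | h
    · linarith
    · exact absurd h hp
  have hp0 : 0 ≤ p := by nlinarith [sq_nonneg q, sq_nonneg p]
  have hr0 : 0 ≤ r := by nlinarith [sq_nonneg q, sq_nonneg r]
  have aux : ∀ u D : ℝ, 0 < D → ∃ δ > 0, ∀ ε, 0 < ε → ε ≤ δ → ε * u ^ 2 < 4 * (p + r) * D := by
    intro u D hD
    refine ⟨4 * (p + r) * D / (u ^ 2 + 1), by positivity, fun ε h0 h => ?_⟩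
    rw [le_div_iff₀ (by positivity)] at h
    nlinarith
  obtain ⟨d₁, hd₁, H₁⟩ := aux (b₁ - c₁) D₁ h₁
  obtain ⟨d₂, hd₂, H₂⟩ := aux (b₂ - c₂) D₂ h₂
  obtain ⟨ε, h0, hε₁, hε₂⟩ : ∃ ε, 0 < ε ∧ ε ≤ d₁ ∧ ε ≤ d₂ :=
    ⟨min d₁ d₂, lt_min hd₁ hd₂, min_le_left _ _, min_le_right _ _⟩
  have hdet : (p + ε) * (r + ε) - q ^ 2 = ε * (p + r + ε) := by linear_combination hd
  have fin : ∀ b e c D : ℝ, 0 < D → p * b + q * e - r * c = 0 → ε * (b - c) ^ 2 < 4 * (p + r) * D →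
      ((p + ε) * b + q * e - (r + ε) * c) ^ 2 < 4 * ((p + ε) * (r + ε) - q ^ 2) * D := by
    intro b e c D hD hl h
    have : (p + ε) * b + q * e - (r + ε) * c = ε * (b - c) := by linear_combination hl
    rw [this, hdet]
    have h1 := mul_lt_mul_of_pos_left h h0
    have h2 : 0 < ε * ε * D := by positivity
    nlinarith
  exact ⟨p + ε, q, r + ε, by linarith, by rw [hdet]; positivity,
    fin _ _ _ _ h₁ l₁ (H₁ ε h0 hε₁), fin _ _ _ _ h₂ l₂ (H₂ ε h0 hε₂)⟩

lemma good_par (b e c k₁ k₂ D₁ D₂ : ℝ) (h₁ : 0 < D₁) (h₂ : 0 < D₂)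
    (g₁ : 0 < 4 * D₁ + k₁ ^ 2 * (e ^ 2 + 4 * b * c))
    (g₂ : 0 < 4 * D₂ + k₂ ^ 2 * (e ^ 2 + 4 * b * c)) :
    Good (k₁ * b) (k₁ * e) (k₁ * c) D₁ (k₂ * b) (k₂ * e) (k₂ * c) D₂ := by
  rcases lt_or_ge (e ^ 2 + 4 * b * c) 0 with h | h
  · have fin : ∀ s k D : ℝ, s ^ 2 = 1 → 0 < 4 * D + k ^ 2 * (e ^ 2 + 4 * b * c) →
        (s * c * (k * b) + s * (e / 2) * (k * e) - s * (-b) * (k * c)) ^ 2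
          < 4 * (s * c * (s * (-b)) - (s * (e / 2)) ^ 2) * D := by
      intro s k D hs g
      have e1 : (s * c * (k * b) + s * (e / 2) * (k * e) - s * (-b) * (k * c)) ^ 2
        = k ^ 2 * (e ^ 2 + 4 * b * c) ^ 2 / 4 := by
        linear_combination (k ^ 2 * (e ^ 2 + 4 * b * c) ^ 2 / 4) * hs
      have e2 : 4 * (s * c * (s * (-b)) - (s * (e / 2)) ^ 2) * D = -(e ^ 2 + 4 * b * c) * D := by
        linear_combination (-(e ^ 2 + 4 * b * c) * D) * hs
      rw [e1, e2]
      nlinarith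
    have hc : c ≠ 0 := by rintro rfl; nlinarith [sq_nonneg e]
    rcases lt_or_gt_of_ne hc with hc | hc
    · exact ⟨-1 * c, -1 * (e / 2), -1 * (-b), by linarith, by nlinarith,
        fin _ _ _ (by norm_num) g₁, fin _ _ _ (by norm_num) g₂⟩
    · exact ⟨1 * c, 1 * (e / 2), 1 * (-b), by linarith, by nlinarith,
        fin _ _ _ (by norm_num) g₁, fin _ _ _ (by norm_num) g₂⟩
  · obtain ⟨w, hw⟩ : ∃ w, w ^ 2 = e ^ 2 + 4 * b * c := ⟨_, Real.sq_sqrt h⟩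
    have main : ∀ x y : ℝ, x ≠ 0 ∨ y ≠ 0 → x ^ 2 * b + x * y * e - y ^ 2 * c = 0 →
        Good (k₁ * b) (k₁ * e) (k₁ * c) D₁ (k₂ * b) (k₂ * e) (k₂ * c) D₂ := by
      intro x y hxy hl
      refine good_null h₁ h₂ (x ^ 2) (x * y) (y ^ 2) (by ring) (by simpa using hxy) ?_ ?_
      · linear_combination k₁ * hl
      · linear_combination k₂ * hl
    by_cases hb : b = 0
    · exact main 1 0 (by simp) (by simp [hb])
    · refine main (w - e) (2 * b) (by right; simpa using hb) ?_
      linear_combination b * hw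

lemma good_main (b₁ e₁ c₁ D₁ b₂ e₂ c₂ D₂ : ℝ) (h₁ : 0 < D₁) (h₂ : 0 < D₂)
    (g₁ : 0 < 4 * D₁ + (e₁ ^ 2 + 4 * b₁ * c₁)) (g₂ : 0 < 4 * D₂ + (e₂ ^ 2 + 4 * b₂ * c₂))
    (hc : 0 ≤ (c₁ * e₂ - e₁ * c₂) * (b₁ * e₂ - e₁ * b₂) - (b₁ * c₂ - c₁ * b₂) ^ 2) :
    Good b₁ e₁ c₁ D₁ b₂ e₂ c₂ D₂ := by
  have l₁ : (c₁ * e₂ - e₁ * c₂) * b₁ + (b₁ * c₂ - c₁ * b₂) * e₁ - (b₁ * e₂ - e₁ * b₂) * c₁ = 0 := by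
    ring
  have l₂ : (c₁ * e₂ - e₁ * c₂) * b₂ + (b₁ * c₂ - c₁ * b₂) * e₂ - (b₁ * e₂ - e₁ * b₂) * c₂ = 0 := by
    ring
  rcases hc.lt_or_eq with hc | hc
  · generalize c₁ * e₂ - e₁ * c₂ = p at *
    generalize b₁ * c₂ - c₁ * b₂ = q at *
    generalize b₁ * e₂ - e₁ * b₂ = r at *
    have hp : p ≠ 0 := by rintro rfl; nlinarith [sq_nonneg q]
    rcases lt_or_gt_of_ne hp with hp | hp
    · have e : -p * -r - (-q) ^ 2 = p * r - q ^ 2 := by ring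
      refine ⟨-p, -q, -r, by linarith, by linarith, ?_, ?_⟩
      · rw [e, show -p * b₁ + -q * e₁ - -r * c₁ = 0 by linarith]
        have : 0 < 4 * (p * r - q ^ 2) * D₁ := by positivity
        simpa using this
      · rw [e, show -p * b₂ + -q * e₂ - -r * c₂ = 0 by linarith]
        have : 0 < 4 * (p * r - q ^ 2) * D₂ := by positivity
        simpa using this
    · refine ⟨p, q, r, hp, hc, ?_, ?_⟩
      · rw [l₁]
        have : 0 < 4 * (p * r - q ^ 2) * D₁ := by positivity
        simpa using this
      · rw [l₂]
        have : 0 < 4 * (p * r - q ^ 2) * D₂ := by positivity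
        simpa using this
  · by_cases hne : c₁ * e₂ - e₁ * c₂ ≠ 0 ∨ b₁ * e₂ - e₁ * b₂ ≠ 0
    · exact good_null h₁ h₂ _ _ _ hc.symm hne l₁ l₂
    · push Not at hne
      obtain ⟨z1, z2⟩ := hne
      have z3 : b₁ * c₂ - c₁ * b₂ = 0 := by
        rw [z1, z2] at hc
        have : (b₁ * c₂ - c₁ * b₂) ^ 2 = 0 := by linarith
        exact pow_eq_zero_iff (two_ne_zero) |>.mp this
      by_cases hz : b₁ = 0 ∧ e₁ = 0 ∧ c₁ = 0
      · obtain ⟨rfl, rfl, rfl⟩ := hz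
        have := good_par b₂ e₂ c₂ 0 1 D₁ D₂ h₁ h₂ (by linarith) (by linarith)
        simpa using this
      · obtain ⟨k, hk1, hk2, hk3⟩ : ∃ k, b₂ = k * b₁ ∧ e₂ = k * e₁ ∧ c₂ = k * c₁ := by
          by_cases hb : b₁ = 0
          · by_cases he : e₁ = 0
            · have hcc : c₁ ≠ 0 := by tauto
              refine ⟨c₂ / c₁, ?_, ?_, ?_⟩ <;> field_simp <;> linarith
            · refine ⟨e₂ / e₁, ?_, ?_, ?_⟩ <;> field_simp <;> linarith
          · refine ⟨b₂ / b₁, ?_, ?_, ?_⟩ <;> field_simp <;> linarith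
        subst hk1 hk2 hk3
        have := good_par b₁ e₁ c₁ 1 k D₁ D₂ h₁ h₂ (by linarith) (by linarith)
        simpa using this

lemma lyap (a b c d p q r : ℝ) (ht : a + d < 0) (hp : 0 < p) (hP : 0 < p * r - q ^ 2)
    (h : (p * b + q * (d - a) - r * c) ^ 2 < 4 * (p * r - q ^ 2) * (a * d - b * c)) :
    (-((!![a, b; c, d] : Matrix (Fin 2) (Fin 2) ℝ)ᵀ * !![p, q; q, r]
      + !![p, q; q, r] * !![a, b; c, d])).PosDef := by
  have e : (-((!![a, b; c, d] : Matrix (Fin 2) (Fin 2) ℝ)ᵀ * !![p, q; q, r]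
      + !![p, q; q, r] * !![a, b; c, d])) =
      !![-(2 * (p * a + q * c)), -(p * b + q * d + q * a + r * c);
        -(p * b + q * d + q * a + r * c), -(2 * (q * b + r * d))] := by
    ext i j
    fin_cases i <;> fin_cases j <;> simp [Matrix.mul_apply, Fin.sum_univ_two] <;> ring
  rw [e]
  have hdet : 0 < -(2 * (p * a + q * c)) * -(2 * (q * b + r * d))
      - (-(p * b + q * d + q * a + r * c)) ^ 2 := by nlinarith
  refine posDef_two _ _ _ ?_ hdet
  have htr : r * -(2 * (p * a + q * c)) - 2 * q * -(p * b + q * d + q * a + r * c)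
      + p * -(2 * (q * b + r * d)) = -2 * (p * r - q ^ 2) * (a + d) := by ring
  have htr2 : 0 < -2 * (p * r - q ^ 2) * (a + d) := by nlinarith [mul_pos hP (neg_pos.2 ht)]
  rw [← htr] at htr2
  generalize -(2 * (p * a + q * c)) = x at *
  generalize -(p * b + q * d + q * a + r * c) = y at *
  generalize -(2 * (q * b + r * d)) = z at *
  by_contra hx
  push Not at hx
  have h1 : x * (r * x - 2 * q * y + p * z) ≤ 0 := mul_nonpos_of_nonpos_of_nonneg hx htr2.le
  have h2 : 0 < p * (p * (x * z - y ^ 2)) := by positivity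
  have h3 : p * (x * (r * x - 2 * q * y + p * z)) ≤ 0 := mul_nonpos_of_nonneg_of_nonpos hp.le h1
  nlinarith [sq_nonneg (p * y - q * x), mul_nonneg hP.le (sq_nonneg x)]

theorem stmt_6 (A₁ A₂ : Matrix (Fin 2) (Fin 2) ℝ)
    (h₁ : Hurwitz A₁) (h₂ : Hurwitz A₂)
    (hcomm : 0 ≤ (A₁ * A₂ - A₂ * A₁).det) :
    ∃ P : Matrix (Fin 2) (Fin 2) ℝ, P.IsSymm ∧ P.PosDef ∧
      (-(A₁ᵀ * P + P * A₁)).PosDef ∧ (-(A₂ᵀ * P + P * A₂)).PosDef := by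
  obtain ⟨t₁, d₁⟩ := h₁
  obtain ⟨t₂, d₂⟩ := h₂
  rw [Matrix.eta_fin_two A₁, Matrix.eta_fin_two A₂] at *
  generalize A₁ 0 0 = a₁ at *
  generalize A₁ 0 1 = b₁ at *
  generalize A₁ 1 0 = c₁ at *
  generalize A₁ 1 1 = f₁ at *
  generalize A₂ 0 0 = a₂ at *
  generalize A₂ 0 1 = b₂ at *
  generalize A₂ 1 0 = c₂ at *
  generalize A₂ 1 1 = f₂ at *
  simp [Matrix.trace_fin_two, Matrix.det_fin_two] at t₁ t₂ d₁ d₂ hcomm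
  obtain ⟨p, q, r, hp, hP, i₁, i₂⟩ := good_main b₁ (f₁ - a₁) c₁ (a₁ * f₁ - b₁ * c₁)
    b₂ (f₂ - a₂) c₂ (a₂ * f₂ - b₂ * c₂) (by linarith) (by linarith)
    (by nlinarith) (by nlinarith) (by linarith)
  refine ⟨!![p, q; q, r], ?_, posDef_two _ _ _ hp hP, lyap _ _ _ _ _ _ _ t₁ hp hP i₁,
    lyap _ _ _ _ _ _ _ t₂ hp hP i₂⟩
  ext i j; fin_cases i <;> fin_cases j <;> simp
end

section
/- Let A₁ and A₂ be Hurwitz real 2×2 matrices. Then det(σA₁ + (1−σ)A₂) > 0 for every σ ∈ [0,1] if and only if Γ(A₁,A₂) > −√(det(A₁)det(A₂)). -/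
open Matrix

/-- Γ(X,Y) := (1/2)(tr X · tr Y − tr (XY)). -/
noncomputable def Gam (X Y : Matrix (Fin 2) (Fin 2) ℝ) : ℝ :=
  (1 / 2) * (X.trace * Y.trace - (X * Y).trace)

theorem det_comb (A B : Matrix (Fin 2) (Fin 2) ℝ) (s t : ℝ) :
    (s • A + t • B).det = s ^ 2 * A.det + 2 * s * t * Gam A B + t ^ 2 * B.det := by
  simp [Gam, Matrix.det_fin_two, Matrix.trace_fin_two, Matrix.mul_apply, Fin.sum_univ_two]
  ring

theorem stmt_14 (A₁ A₂ : Matrix (Fin 2) (Fin 2) ℝ)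
    (h₁ : Hurwitz A₁) (h₂ : Hurwitz A₂) :
    (∀ σ ∈ Set.Icc (0:ℝ) 1, 0 < (σ • A₁ + (1 - σ) • A₂).det) ↔
      Gam A₁ A₂ > - Real.sqrt (A₁.det * A₂.det) := by
  have hd₁ := h₁.2
  have hd₂ := h₂.2
  simp only [det_comb]
  generalize Gam A₁ A₂ = g
  rw [Real.sqrt_mul hd₁.le]
  have hp := Real.sqrt_pos.2 hd₁
  have hq := Real.sqrt_pos.2 hd₂
  have hp2 := Real.sq_sqrt hd₁.le
  have hq2 := Real.sq_sqrt hd₂.le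
  generalize √A₁.det = p at *
  generalize √A₂.det = q at *
  rw [← hp2, ← hq2]
  have hpq : 0 < p + q := by positivity
  constructor
  · intro h
    have h' := h (q / (p + q)) ⟨by positivity, by rw [div_le_one hpq]; linarith⟩
    have e : (q / (p + q)) ^ 2 * p ^ 2 + 2 * (q / (p + q)) * (1 - q / (p + q)) * g
        + (1 - q / (p + q)) ^ 2 * q ^ 2 = (2 * (p * q) / (p + q) ^ 2) * (g + p * q) := by
      field_simp
      ring
    rw [e] at h'
    have := pos_of_mul_pos_right h' (by positivity)
    linarith
  · rintro h σ ⟨h0, h1⟩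
    have e : σ ^ 2 * p ^ 2 + 2 * σ * (1 - σ) * g + (1 - σ) ^ 2 * q ^ 2
        = (σ * p - (1 - σ) * q) ^ 2 + 2 * (σ * (1 - σ)) * (g + p * q) := by ring
    rcases h0.eq_or_lt with rfl | h0
    · simp; positivity
    rcases h1.eq_or_lt with rfl | h1
    · simp; positivity
    rw [e]
    have h2 : 0 < 1 - σ := by linarith
    have h3 : 0 < g + p * q := by linarith
    positivity
end
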